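/- arXiv:1705.09224 — 2 statements merged into one kernel-verified Lean document; each statement's English description precedes it below -/
import Mathlib

section
/- Let A be a Dedekind domain which is not a field, let α be the cardinality of the set of maximal ideals of A, and let M be a nonzero A-submodule of Frac(A). Let S be the set of maximal ideals 𝔪 of A such that M is not contained in the localization A_𝔪 (viewed as a subring of Frac(A)), and let γ be the cardinality of S. Then the set of A-submodules of M has cardinality exactly max(α, 2^γ, ℵ₀). In particular, if M is a minimax A-module, this cardinality is max(α, ℵ₀). -/
open Cardinal

namespace CardSub

/-- Every nonzero element is, locally at `m`, a unit times a power of a uniformizer. -/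
lemma exists_unif {A : Type*} [CommRing A] [IsDedekindDomain A] (m : Ideal A) [hm : m.IsPrime]
    (h0 : m ≠ ⊥) : ∃ π : A, π ≠ 0 ∧ ∀ p : A, p ≠ 0 →
      ∃ (i : ℕ) (b c : A), b ∉ m ∧ c ∉ m ∧ b * p = c * π ^ i := by
  have : IsDiscreteValuationRing (Localization.AtPrime m) :=
    IsLocalization.AtPrime.isDiscreteValuationRing_of_dedekind_domain A h0 _
  have hinj : Function.Injective (algebraMap A (Localization.AtPrime m)) :=
    IsLocalization.injective _ m.primeCompl_le_nonZeroDivisors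
  obtain ⟨ϖ, hϖ⟩ := IsDiscreteValuationRing.exists_irreducible (Localization.AtPrime m)
  obtain ⟨⟨π, s⟩, hπ⟩ := IsLocalization.mk'_surjective m.primeCompl ϖ
  have h1 : algebraMap A (Localization.AtPrime m) π
      = ϖ * algebraMap A (Localization.AtPrime m) s := by
    rw [← hπ]; exact (IsLocalization.mk'_spec _ _ _).symm
  have hs : IsUnit (algebraMap A (Localization.AtPrime m) s) :=
    IsLocalization.map_units _ s
  have hirr : Irreducible (algebraMap A (Localization.AtPrime m) π) := by
    rw [h1]
    exact (irreducible_mul_isUnit hs).2 hϖ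
  refine ⟨π, ?_, ?_⟩
  · rintro rfl
    exact hirr.ne_zero (map_zero _)
  · intro p hp
    have hp' : algebraMap A (Localization.AtPrime m) p ≠ 0 := by
      intro h
      exact hp (hinj (by rw [h, map_zero]))
    obtain ⟨i, u, hu⟩ := IsDiscreteValuationRing.associated_pow_irreducible hp' hirr
    obtain ⟨⟨c, t⟩, hc⟩ := IsLocalization.mk'_surjective m.primeCompl (u : Localization.AtPrime m)
    have hcu : c ∈ m.primeCompl := by
      rw [← IsLocalization.AtPrime.isUnit_mk'_iff (Localization.AtPrime m) m c t]
      have := u.isUnit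
      rw [← hc] at this
      exact this
    have h2 : algebraMap A (Localization.AtPrime m) c
        = u * algebraMap A (Localization.AtPrime m) t := by
      rw [← hc]; exact (IsLocalization.mk'_spec _ _ _).symm
    refine ⟨i, c, t, hcu, t.2, hinj ?_⟩
    rw [map_mul, map_mul, map_pow, ← hu, h2]
    ring

section
variable {A : Type*} [CommRing A] [IsDedekindDomain A]
  {K : Type*} [Field K] [Algebra A K] [IsFractionRing A K]

lemma mem_of_local (N : Submodule A K) (y : K)
    (h : ∀ m : Ideal A, m.IsMaximal → ∃ b : A, b ∉ m ∧ b • y ∈ N) : y ∈ N := by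
  by_contra hy
  have hne : N.comap (LinearMap.toSpanSingleton A K y) ≠ ⊤ := by
    intro h
    have : (1 : A) ∈ N.comap (LinearMap.toSpanSingleton A K y) := by rw [h]; trivial
    simp at this
    exact hy this
  obtain ⟨m, hm, hle⟩ := Ideal.exists_le_maximal _ hne
  obtain ⟨b, hb, hby⟩ := h m hm
  exact hb (hle (by simpa using hby))

/-- Trichotomy-like statement for elements of the fraction field. -/
lemma exists_unif_frac (m : Ideal A) [hm : m.IsPrime]
    (h0 : m ≠ ⊥) : ∃ π : A, π ≠ 0 ∧ ∀ y : K,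
      (∃ a b : A, b ∉ m ∧ b • y = algebraMap A K a) ∨
      ∃ (k : ℕ) (b c : A), b ∉ m ∧ c ∉ m ∧ (b * π ^ k) • y = algebraMap A K c := by
  obtain ⟨π, hπ, H⟩ := exists_unif m h0
  refine ⟨π, hπ, fun y => ?_⟩
  by_cases hy : y = 0
  · exact Or.inl ⟨0, 1, fun h => hm.ne_top ((Ideal.eq_top_iff_one _).2 h), by simp [hy]⟩
  obtain ⟨p, q, hq, rfl⟩ := IsFractionRing.div_surjective (A := A) y
  have hq0 : q ≠ 0 := nonZeroDivisors.ne_zero hq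
  have hp0 : p ≠ 0 := by rintro rfl; simp at hy
  have hqK : algebraMap A K q ≠ 0 := by simpa using hq0
  have hπK : algebraMap A K π ≠ 0 := by simpa using hπ
  obtain ⟨i, b, c, hb, hc, h1⟩ := H p hp0
  obtain ⟨j, b', c', hb', hc', h2⟩ := H q hq0
  have h1' := congrArg (algebraMap A K) h1
  have h2' := congrArg (algebraMap A K) h2
  simp only [map_mul, map_pow] at h1' h2'
  have hbc : b * c' ∉ m := fun h => (hm.mem_or_mem h).elim hb hc'
  have hcb : c * b' ∉ m := fun h => (hm.mem_or_mem h).elim hc hb'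
  rcases le_total j i with hij | hij
  · left
    obtain ⟨k, rfl⟩ := Nat.exists_eq_add_of_le hij
    refine ⟨c * b' * π ^ k, b * c', hbc, ?_⟩
    rw [Algebra.smul_def]
    simp only [map_mul, map_pow]
    have hpj : algebraMap A K π ^ j ≠ 0 := pow_ne_zero _ hπK
    field_simp
    apply mul_right_cancel₀ hpj
    rw [pow_add] at h1'
    linear_combination (algebraMap A K c' * algebraMap A K π ^ j) * h1'
      - (algebraMap A K c * algebraMap A K π ^ j * algebraMap A K π ^ k) * h2'
  · right
    obtain ⟨k, rfl⟩ := Nat.exists_eq_add_of_le hij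
    refine ⟨k, b * c', c * b', hbc, hcb, ?_⟩
    rw [Algebra.smul_def]
    simp only [map_mul, map_pow]
    have hpj : algebraMap A K π ^ i ≠ 0 := pow_ne_zero _ hπK
    field_simp
    apply mul_right_cancel₀ hpj
    rw [pow_add] at h2'
    linear_combination (algebraMap A K c' * algebraMap A K π ^ i * algebraMap A K π ^ k) * h1'
      - (algebraMap A K c * algebraMap A K π ^ i) * h2'

/-- The localization is a valuation ring. -/
lemma val_total (m : Ideal A) [hm : m.IsPrime] (h0 : m ≠ ⊥) (y z : K) :
    (∃ b c : A, b ∉ m ∧ b • y = c • z) ∨ (∃ b c : A, b ∉ m ∧ b • z = c • y) := by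
  by_cases hz : z = 0
  · right
    exact ⟨1, 0, fun h => hm.ne_top ((Ideal.eq_top_iff_one _).2 h), by simp [hz]⟩
  obtain ⟨π, hπ, H⟩ := exists_unif_frac (K := K) m h0
  rcases H (y / z) with ⟨a, b, hb, h⟩ | ⟨k, b, c, hb, hc, h⟩
  · left
    refine ⟨b, a, hb, ?_⟩
    rw [Algebra.smul_def] at h ⊢
    rw [Algebra.smul_def, ← h]
    field_simp
  · right
    refine ⟨c, b * π ^ k, hc, ?_⟩
    rw [Algebra.smul_def] at h ⊢
    rw [Algebra.smul_def, ← h]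
    field_simp

/-- Distributivity: a submodule is determined by its intersection and sum with `A`. -/
lemma le_of_inf_sup (hnf : ¬ IsField A) (N N' : Submodule A K)
    (h1 : ∀ a : A, algebraMap A K a ∈ N → algebraMap A K a ∈ N')
    (h2 : N ≤ N' ⊔ 1) : N ≤ N' := by
  intro y hy
  apply mem_of_local
  intro m hm
  have := hm.isPrime
  have h0 := Ring.ne_bot_of_isMaximal_of_not_isField hm hnf
  obtain ⟨y', hy', w, hw, hyw⟩ := Submodule.mem_sup.1 (h2 hy)
  obtain ⟨a, rfl⟩ := Submodule.mem_one.1 hw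
  have key : (∃ b a : A, b ∉ m ∧ b • y = algebraMap A K a) → ∃ b, b ∉ m ∧ b • y ∈ N' := by
    rintro ⟨b, a, hb, h⟩
    refine ⟨b, hb, ?_⟩
    rw [h]
    apply h1
    rw [← h]
    exact N.smul_mem _ hy
  rcases val_total m h0 y y' with ⟨b, c, hb, h⟩ | ⟨b, c, hb, h⟩
  · exact ⟨b, hb, by rw [h]; exact N'.smul_mem _ hy'⟩
  · by_cases hc : c ∈ m
    · apply key
      refine ⟨b - c, b * a, fun h => hb (by simpa using m.add_mem h hc), ?_⟩
      rw [sub_smul, ← h, ← hyw, smul_add, map_mul, Algebra.smul_def b (algebraMap A K a)]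
      ring
    · exact ⟨c, hc, by rw [← h]; exact N'.smul_mem _ hy'⟩

/-- The localization at `m` as a submodule of `K`. -/
def locSub (K : Type*) [Field K] [Algebra A K] (m : Ideal A) [hm : m.IsPrime] :
    Submodule A K where
  carrier := {x | ∃ a b : A, b ∉ m ∧ algebraMap A K b * x = algebraMap A K a}
  zero_mem' := ⟨0, 1, fun h => hm.ne_top ((Ideal.eq_top_iff_one _).2 h), by simp⟩
  add_mem' := by
    rintro x y ⟨a, b, hb, h⟩ ⟨a', b', hb', h'⟩
    refine ⟨b' * a + b * a', b * b', fun h => (hm.mem_or_mem h).elim hb hb', ?_⟩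
    simp only [map_mul, map_add, ← h, ← h']
    ring
  smul_mem' := by
    rintro c x ⟨a, b, hb, h⟩
    refine ⟨c * a, b, hb, ?_⟩
    rw [Algebra.smul_def, map_mul, ← h]
    ring

lemma mem_locSub (m : Ideal A) [hm : m.IsPrime] (x : K) :
    x ∈ locSub K m ↔ ∃ a b : A, b ∉ m ∧ algebraMap A K b * x = algebraMap A K a := Iff.rfl

/-- Move an element to have poles only at `m`. -/
lemma exists_pole (hnf : ¬ IsField A) (m : Ideal A) [hm : m.IsMaximal] (x : K)
    (hx : x ∉ locSub K m) : ∃ a : A, a • x ∉ locSub K m ∧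
      ∀ (n : Ideal A) [n.IsMaximal], n ≠ m → a • x ∈ locSub K n := by
  have h0 := Ring.ne_bot_of_isMaximal_of_not_isField hm hnf
  obtain ⟨p, q, hq, rfl⟩ := IsFractionRing.div_surjective (A := A) x
  have hq0 : q ≠ 0 := nonZeroDivisors.ne_zero hq
  have hqK : algebraMap A K q ≠ 0 := by simpa using hq0
  obtain ⟨J, hJ, hmJ⟩ := FiniteMultiplicity.exists_eq_pow_mul_and_not_dvd
    (FiniteMultiplicity.of_prime_left (Ideal.prime_of_isPrime h0 hm.isPrime)
      (b := Ideal.span {q}) (by simpa using hq0))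
  generalize multiplicity m (Ideal.span {q}) = k at hJ
  rw [Ideal.dvd_iff_le] at hmJ
  obtain ⟨a, haJ, ham⟩ := SetLike.not_le_iff_exists.1 hmJ
  refine ⟨a, ?_, ?_⟩
  · rintro ⟨c, b, hb, h⟩
    refine hx ⟨c, b * a, fun h => (hm.isPrime.mem_or_mem h).elim hb ham, ?_⟩
    rw [← h, Algebra.smul_def, map_mul, mul_assoc]
  · intro n hn hnm
    have : ¬ m ^ k ≤ n := by
      intro h
      have := hn.isPrime.le_of_pow_le h
      exact hnm (hm.eq_of_le hn.ne_top this).symm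
    obtain ⟨b, hb, hbn⟩ := SetLike.not_le_iff_exists.1 this
    have hba : b * a ∈ Ideal.span {q} := by rw [hJ]; exact Ideal.mul_mem_mul hb haJ
    obtain ⟨c, hc⟩ := Ideal.mem_span_singleton.1 hba
    refine ⟨c * p, b, hbn, ?_⟩
    have := congrArg (algebraMap A K) hc
    simp only [map_mul] at this ⊢
    rw [Algebra.smul_def]
    field_simp
    linear_combination algebraMap A K p * this

end

lemma mk_ideal_le {A : Type*} [CommRing A] [IsDedekindDomain A] (hnf : ¬ IsField A) :
    #(Ideal A) ≤ max #{I : Ideal A // I.IsMaximal} ℵ₀ := by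
  have hs : Function.Surjective (fun l : Option (List {I : Ideal A // I.IsMaximal}) =>
      (l.elim ⊥ (fun l => (l.map Subtype.val).prod) : Ideal A)) := by
    intro I
    by_cases hI : I = ⊥
    · exact ⟨none, hI.symm⟩
    obtain ⟨f, hf, hfI⟩ := UniqueFactorizationMonoid.exists_prime_factors I hI
    rw [associated_iff_eq] at hfI
    have : ∀ b ∈ f.toList, b.IsMaximal := by
      intro b hb
      have hb := hf b (by simpa using hb)
      exact (Ideal.isPrime_of_prime hb).isMaximal hb.ne_zero
    refine ⟨some (f.toList.attach.map fun b => ⟨b.1, this b.1 b.2⟩), ?_⟩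
    change (List.map Subtype.val (List.map _ f.toList.attach)).prod = I
    rw [List.map_map]
    refine Eq.trans (congrArg List.prod (List.attach_map_subtype_val f.toList)) ?_
    rw [Multiset.prod_toList, hfI]
  refine (mk_le_of_surjective hs).trans ?_
  rw [mk_option]
  refine add_le_of_le (le_max_right _ _) ?_ (one_le_aleph0.trans (le_max_right _ _))
  rw [max_comm]
  exact mk_list_le_max _

lemma countable_lowerSets : Countable {s : Set ℕ // ∀ k ∈ s, ∀ j ≤ k, j ∈ s} := by
  have : {s : Set ℕ | ∀ k ∈ s, ∀ j ≤ k, j ∈ s} ⊆ {Set.univ} ∪ Set.range (fun n : ℕ => Set.Iio n) := by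
    intro s hs
    by_cases h : s = Set.univ
    · exact Or.inl h
    right
    classical
    have hex : ∃ n, n ∉ s := by
      by_contra! hh
      exact h (Set.eq_univ_of_forall hh)
    refine ⟨Nat.find hex, ?_⟩
    ext j
    simp only [Set.mem_Iio]
    constructor
    · intro hj
      by_contra hjs
      exact Nat.find_min hex hj hjs
    · intro hj
      by_contra! hle
      exact Nat.find_spec hex (hs j hj _ hle)
  exact (((Set.countable_singleton _).union (Set.countable_range _)).mono this).to_subtype

lemma aleph0_power_le (γ : Cardinal) : ℵ₀ ^ γ ≤ max (2 ^ γ) ℵ₀ := by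
  rcases lt_or_ge γ ℵ₀ with h | h
  · obtain ⟨n, rfl⟩ := lt_aleph0.1 h
    exact le_max_of_le_right (by exact_mod_cast power_nat_le (n := n) le_rfl)
  · rw [power_eq_two_power h (natCast_le_aleph0 (n := 2)) h]
    exact le_max_left _ _

section
variable {A : Type u} [CommRing A] [IsDedekindDomain A]
  {K : Type u} [Field K] [Algebra A K] [IsFractionRing A K]

/-- The pole orders (with respect to `π`) at `m` of elements of `P`. -/
def code (m : Ideal A) (π : A) (P : Submodule A K) : {s : Set ℕ // ∀ k ∈ s, ∀ j ≤ k, j ∈ s} :=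
  ⟨{k | ∃ b : A, b ∉ m ∧ ∃ y ∈ P, π ^ k • y = algebraMap A K b}, by
    rintro k ⟨b, hb, y, hy, h⟩ j hjk
    obtain ⟨l, rfl⟩ := Nat.exists_eq_add_of_le hjk
    refine ⟨b, hb, π ^ l • y, P.smul_mem _ hy, ?_⟩
    rw [← h, smul_smul, pow_add]⟩

lemma le_of_code (hnf : ¬ IsField A) (M P P' : Submodule A K) (π : Ideal A → A)
    (hπ : ∀ m : Ideal A, m.IsMaximal → π m ≠ 0 ∧ ∀ y : K,
      (∃ a b : A, b ∉ m ∧ b • y = algebraMap A K a) ∨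
      ∃ (k : ℕ) (b c : A), b ∉ m ∧ c ∉ m ∧ (b * π m ^ k) • y = algebraMap A K c)
    (h1 : 1 ≤ P') (hPM : P ≤ M ⊔ 1)
    (h : ∀ m : Ideal A, m.IsMaximal → (¬ ∀ x ∈ M, ∃ a b : A, b ∉ m ∧
              algebraMap A K b * x = algebraMap A K a) →
      (code m (π m) P).1 ⊆ (code m (π m) P').1) : P ≤ P' := by
  intro y hy
  apply mem_of_local
  intro m hm
  have := hm.isPrime
  have key : (∃ a b : A, b ∉ m ∧ b • y = algebraMap A K a) → ∃ b, b ∉ m ∧ b • y ∈ P' := by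
    rintro ⟨a, b, hb, h⟩
    exact ⟨b, hb, by rw [h]; exact h1 (Submodule.mem_one.2 ⟨a, rfl⟩)⟩
  by_cases hS : ∀ x ∈ M, ∃ a b : A, b ∉ m ∧ algebraMap A K b * x = algebraMap A K a
  · apply key
    have hle : M ⊔ 1 ≤ locSub K m := by
      refine sup_le hS ?_
      intro z hz
      obtain ⟨a, rfl⟩ := Submodule.mem_one.1 hz
      exact ⟨a, 1, fun h => hm.ne_top ((Ideal.eq_top_iff_one _).2 h), by simp⟩
    obtain ⟨a, b, hb, hab⟩ := hle (hPM hy)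
    exact ⟨a, b, hb, by rw [Algebra.smul_def, hab]⟩
  · rcases (hπ m hm).2 y with hh | ⟨k, b, c, hb, hc, hh⟩
    · exact key hh
    · have hk : k ∈ (code m (π m) P).1 :=
        ⟨c, hc, b • y, P.smul_mem _ hy, by rw [← hh, smul_smul, mul_comm]⟩
      obtain ⟨c', hc', y', hy', h'⟩ := h m hm hS hk
      refine ⟨c' * b, fun h => (hm.isPrime.mem_or_mem h).elim hc' hb, ?_⟩
      have : (c' * b) • y = c • y' := by
        have hpK : algebraMap A K (π m) ^ k ≠ 0 := pow_ne_zero _ (by simpa using (hπ m hm).1)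
        apply mul_left_cancel₀ hpK
        simp only [Algebra.smul_def, map_mul, map_pow] at hh h' ⊢
        linear_combination (algebraMap A K c') * hh - algebraMap A K c * h'
      rw [this]
      exact P'.smul_mem _ hy'

lemma card_le (hnf : ¬ IsField A) (M : Submodule A K) :
    #(Submodule A M) ≤ max (max #{I : Ideal A // I.IsMaximal}
          (2 ^ #{m : Ideal A // m.IsMaximal ∧ ¬ ∀ x ∈ M, ∃ a b : A, b ∉ m ∧
              algebraMap A K b * x = algebraMap A K a})) ℵ₀ := by
  set S := {m : Ideal A // m.IsMaximal ∧ ¬ ∀ x ∈ M, ∃ a b : A, b ∉ m ∧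
              algebraMap A K b * x = algebraMap A K a} with hS
  have hex : ∀ m : Ideal A, ∃ π : A, m.IsMaximal → π ≠ 0 ∧ ∀ y : K,
      (∃ a b : A, b ∉ m ∧ b • y = algebraMap A K a) ∨
      ∃ (k : ℕ) (b c : A), b ∉ m ∧ c ∉ m ∧ (b * π ^ k) • y = algebraMap A K c := by
    intro m
    by_cases hm : m.IsMaximal
    · have := hm.isPrime
      obtain ⟨π, h⟩ := exists_unif_frac (K := K) m
        (Ring.ne_bot_of_isMaximal_of_not_isField hm hnf)
      exact ⟨π, fun _ => h⟩
    · exact ⟨0, fun h => absurd h hm⟩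
  choose π hπ using hex
  let F : Submodule A M → Ideal A × (S → {s : Set ℕ // ∀ k ∈ s, ∀ j ≤ k, j ∈ s}) := fun N =>
    ((N.map M.subtype).comap (Algebra.linearMap A K),
      fun m => code m.1 (π m.1) (N.map M.subtype ⊔ 1))
  have hle : ∀ N N', F N = F N' → N ≤ N' := by
    intro N N' h
    obtain ⟨h1, h2⟩ := Prod.ext_iff.1 h
    have : N.map M.subtype ≤ N'.map M.subtype := by
      apply le_of_inf_sup hnf
      · intro a ha
        exact (SetLike.ext_iff.1 h1 a).1 ha
      · refine le_sup_left.trans (le_of_code hnf M (N.map M.subtype ⊔ 1) _ π hπ le_sup_right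
          (sup_le_sup_right (Submodule.map_subtype_le M N) 1) ?_)
        intro m hm hmS
        have := congrFun h2 ⟨m, hm, hmS⟩
        exact (congrArg Subtype.val this).le
    exact (Submodule.map_le_map_iff_of_injective M.injective_subtype _ _).1 this
  have hF : Function.Injective F := fun N N' h => le_antisymm (hle _ _ h) (hle _ _ h.symm)
  have := countable_lowerSets
  have hC : #(S → {s : Set ℕ // ∀ k ∈ s, ∀ j ≤ k, j ∈ s}) ≤ ℵ₀ ^ #S := by
    rw [mk_pi, prod_const, lift_uzero]
    exact power_le_power_right (by simp)
  refine (mk_le_of_injective hF).trans ?_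
  rw [mk_prod]
  simp only [lift_id, lift_uzero]
  refine mul_le_of_le (le_max_right _ _) ((mk_ideal_le hnf).trans ?_)
    (hC.trans ((aleph0_power_le _).trans ?_))
  · exact max_le_max (le_max_left _ _) le_rfl
  · exact max_le_max (le_max_right _ _) le_rfl

/-- Elements of `M` integral at all primes of `T`. -/
def sub (M : Submodule A K) (T : Set (Ideal A)) : Submodule A M :=
  (⨅ m : {m : Ideal A // m.IsMaximal ∧ m ∈ T}, 
    haveI := m.2.1.isPrime; locSub K m.1).comap M.subtype

lemma mem_sub (M : Submodule A K) (T : Set (Ideal A)) (x : M) :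
    x ∈ sub M T ↔ ∀ (m : Ideal A) (_ : m.IsMaximal), m ∈ T → (x : K) ∈ locSub K m := by
  simp only [sub, Submodule.mem_comap, Submodule.mem_iInf, Submodule.coe_subtype]
  exact ⟨fun h m hm hT => h ⟨m, hm, hT⟩, fun h m => h m.1 m.2.1 m.2.2⟩

lemma sub_inj (hnf : ¬ IsField A) (M : Submodule A K) (T T' : Set (Ideal A))
    (h : sub M T ≤ sub M T') (m : Ideal A) (hm : m.IsMaximal)
    (hS : ¬ ∀ x ∈ M, ∃ a b : A, b ∉ m ∧ algebraMap A K b * x = algebraMap A K a)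
    (hmT : m ∈ T') : m ∈ T := by
  by_contra hmn
  push Not at hS
  obtain ⟨x, hx, hxm⟩ := hS
  obtain ⟨a, ha, han⟩ := exists_pole hnf m x (by
    rintro ⟨a, b, hb, h⟩
    exact hxm a b hb h)
  have h1 : a • (⟨x, hx⟩ : M) ∈ sub M T := by
    rw [mem_sub]
    intro n hn hnT
    exact han n (by rintro rfl; exact hmn hnT)
  exact ha ((mem_sub _ _ _).1 (h h1) m hm hmT)

lemma le_card (hnf : ¬ IsField A) (M : Submodule A K) (hM : M ≠ ⊥) :
    max (max #{I : Ideal A // I.IsMaximal}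
          (2 ^ #{m : Ideal A // m.IsMaximal ∧ ¬ ∀ x ∈ M, ∃ a b : A, b ∉ m ∧
              algebraMap A K b * x = algebraMap A K a})) ℵ₀ ≤ #(Submodule A M) := by
  have hI : #(Ideal A) ≤ #(Submodule A M) := by
    obtain ⟨x, hx, hx0⟩ := M.exists_mem_ne_zero_of_ne_bot hM
    have hinj : Function.Injective (LinearMap.toSpanSingleton A M ⟨x, hx⟩) := by
      intro a b hab
      have := congrArg Subtype.val hab
      simp only [LinearMap.toSpanSingleton_apply, SetLike.mk_smul_mk, Algebra.smul_def] at this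
      exact IsFractionRing.injective A K (mul_right_cancel₀ hx0 this)
    exact mk_le_of_injective (Submodule.map_injective_of_injective hinj)
  refine max_le (max_le ?_ ?_) ?_
  · exact (mk_subtype_le _).trans hI
  · rw [← mk_set]
    refine mk_le_of_injective (f := fun T => sub M (Subtype.val '' T)) ?_
    have : ∀ T T' : Set {m : Ideal A // m.IsMaximal ∧ ¬ ∀ x ∈ M, ∃ a b : A, b ∉ m ∧
              algebraMap A K b * x = algebraMap A K a},
        sub M (Subtype.val '' T) = sub M (Subtype.val '' T') → T' ⊆ T := by
      intro T T' h m hm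
      obtain ⟨m', hm', h'⟩ := sub_inj hnf M _ _ h.le m.1 m.2.1 m.2.2 ⟨m, hm, rfl⟩
      rwa [← Subtype.ext h']
    intro T T' h
    exact le_antisymm (this _ _ h.symm) (this _ _ h)
  · refine le_trans ?_ hI
    obtain ⟨m, hm⟩ := Ideal.exists_maximal A
    have := (Ideal.pow_right_strictAnti m
      (Ring.ne_bot_of_isMaximal_of_not_isField hm hnf) hm.ne_top).injective
    have := Infinite.of_injective _ this
    exact aleph0_le_mk _

lemma finite_of_minimax (hnf : ¬ IsField A) (M : Submodule A K)
    (h : ∃ N : Submodule A M, N.FG ∧ IsArtinian A (M ⧸ N)) :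
    Finite {m : Ideal A // m.IsMaximal ∧ ¬ ∀ x ∈ M, ∃ a b : A, b ∉ m ∧
              algebraMap A K b * x = algebraMap A K a} := by
  obtain ⟨N, hN, hart⟩ := h
  obtain ⟨d, hd, hdN⟩ := FractionalIdeal.isFractional_of_fg (S := nonZeroDivisors A)
    (hN.map M.subtype)
  have hd0 : d ≠ 0 := nonZeroDivisors.ne_zero hd
  have hfin : {m : Ideal A | m.IsMaximal ∧ d ∈ m}.Finite := by
    have := (Ideal.finite_factors (I := Ideal.span {d}) (by simpa using hd0)).image
      IsDedekindDomain.HeightOneSpectrum.asIdeal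
    refine this.subset ?_
    rintro m ⟨hm, hdm⟩
    refine ⟨⟨m, hm.isPrime, Ring.ne_bot_of_isMaximal_of_not_isField hm hnf⟩, ?_, rfl⟩
    simpa [Ideal.dvd_span_singleton] using hdm
  set S := {m : Ideal A | m.IsMaximal ∧ ¬ ∀ x ∈ M, ∃ a b : A, b ∉ m ∧
              algebraMap A K b * x = algebraMap A K a} with hS
  change Finite S
  by_contra hinf
  have hinf : S.Infinite := fun h => hinf h
  have hinf' : (S \ {m : Ideal A | m.IsMaximal ∧ d ∈ m}).Infinite := hinf.sdiff hfin
  let e := hinf'.natEmbedding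
  let T : ℕ → Set (Ideal A) := fun n => {m | ∃ i < n, (e i : Ideal A) = m}
  have hanti : ∀ i j, i ≤ j → sub M (T j) ≤ sub M (T i) := by
    intro i j hij x hx
    rw [mem_sub] at hx ⊢
    rintro m hm ⟨l, hl, h⟩
    exact hx m hm ⟨l, hl.trans_le hij, h⟩
  have hNle : ∀ n, N ≤ sub M (T n) := by
    intro n x hx
    rw [mem_sub]
    rintro m hm ⟨l, hl, rfl⟩
    obtain ⟨a, ha⟩ := hdN x ⟨x, hx, rfl⟩
    exact ⟨a, d, fun h => (e l).2.2 ⟨hm, h⟩, by rw [ha, Algebra.smul_def]⟩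
  obtain ⟨n, hn⟩ := IsArtinian.monotone_stabilizes (R := A) (M := M ⧸ N)
    ⟨fun n => OrderDual.toDual ((sub M (T n)).map N.mkQ),
      fun i j hij => Submodule.map_mono (hanti i j hij)⟩
  have h1 : (sub M (T n)).map N.mkQ = (sub M (T (n + 1))).map N.mkQ := hn (n + 1) n.le_succ
  have h2 := congrArg (Submodule.comap N.mkQ) h1
  rw [Submodule.comap_map_mkQ, Submodule.comap_map_mkQ, sup_eq_right.2 (hNle _),
    sup_eq_right.2 (hNle _)] at h2
  obtain ⟨i, hi, h⟩ := sub_inj hnf M _ _ h2.le (e n) (e n).2.1.1 (e n).2.1.2 ⟨n, n.lt_succ_self, rfl⟩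
  exact hi.ne (e.injective (Subtype.ext h))

end

end CardSub

/-- Let `A` be a Dedekind domain which is not a field, `α` the cardinality of its set of
maximal ideals, and `M` a nonzero `A`-submodule of `Frac(A)`.  Let `S` be the set of maximal
ideals `𝔪` such that `M` is not contained in the localization `A_𝔪 ⊆ Frac(A)`, and `γ` its
cardinality.  Then `M` has exactly `max (α, 2^γ, ℵ₀)` submodules; in particular if `M` is
minimax this is `max (α, ℵ₀)`. -/
theorem card_submodules_of_submodule_of_fractionRing
    (A : Type u) [CommRing A] [IsDedekindDomain A] (hnf : ¬ IsField A)
    (M : Submodule A (FractionRing A)) (hM : M ≠ ⊥) :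
    (Cardinal.mk (Submodule A M) =
        max (max (Cardinal.mk {I : Ideal A // I.IsMaximal})
          (2 ^ Cardinal.mk {𝔪 : Ideal A // 𝔪.IsMaximal ∧
            ¬ ∀ x ∈ M, ∃ a b : A, b ∉ 𝔪 ∧
              algebraMap A (FractionRing A) b * x = algebraMap A (FractionRing A) a}))
          Cardinal.aleph0) ∧
      ((∃ N : Submodule A M, N.FG ∧ IsArtinian A (M ⧸ N)) →
        Cardinal.mk (Submodule A M) =
          max (Cardinal.mk {I : Ideal A // I.IsMaximal}) Cardinal.aleph0) := by
  have h1 := le_antisymm (CardSub.card_le hnf M) (CardSub.le_card hnf M hM)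
  refine ⟨h1, fun h => ?_⟩
  have := CardSub.finite_of_minimax hnf M h
  rw [h1]
  refine le_antisymm (max_le (max_le (le_max_left _ _) ?_) (le_max_right _ _))
    (max_le_max (le_max_left _ _) le_rfl)
  refine le_max_of_le_right (le_of_lt ?_)
  exact power_lt_aleph0 (natCast_lt_aleph0 (n := 2)) (lt_aleph0_of_finite _)
end

section
/- Let R be a complete noetherian local ring (a noetherian local ring complete in the topology defined by its maximal ideal 𝔪) with residue field 𝕜 = R/𝔪. Let E be an R-module which is an injective hull of 𝕜, i.e. E is an injective R-module together with an injective R-linear map ι : 𝕜 → E whose image is essential in E (every nonzero submodule of E meets the image of ι nontrivially). For an R-module M set T(M) = Hom_R(M, E). Then for every R-module M the canonical evaluation map M → T(T(M)) = Hom_R(Hom_R(M, E), E), sending m to the map f ↦ f(m), is injective; and it is surjective if and only if M is minimax. -/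
open IsLocalRing

namespace MatlisAux

/-- `e₀` generates the essential simple submodule of the injective module `E`. -/
structure Hull (R : Type*) [CommRing R] [IsLocalRing R] (E : Type*) [AddCommGroup E] [Module R E]
    (e₀ : E) : Prop where
  baer : Module.Baer R E
  ne : e₀ ≠ 0
  kill : ∀ r ∈ maximalIdeal R, r • e₀ = 0
  ess : ∀ N : Submodule R E, N ≠ ⊥ → e₀ ∈ N

/-- Surjectivity of the evaluation map. -/
def Rfl (R : Type*) [CommRing R] (E : Type*) [AddCommGroup E] [Module R E]
    (M : Type*) [AddCommGroup M] [Module R M] : Prop :=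
  ∀ φ : (M →ₗ[R] E) →ₗ[R] E, ∃ m : M, ∀ f : M →ₗ[R] E, φ f = f m

section
variable {R : Type*} [CommRing R] [IsLocalRing R] {E : Type*} [AddCommGroup E] [Module R E] {e₀ : E}

theorem Hull.cog (h : Hull R E e₀) {M : Type*} [AddCommGroup M] [Module R M] {m : M} (hm : m ≠ 0) :
    ∃ f : M →ₗ[R] E, f m ≠ 0 := by
  set I : Ideal R := LinearMap.ker (LinearMap.toSpanSingleton R M m) with hI
  have hIm : I ≤ maximalIdeal R := by
    apply le_maximalIdeal
    intro htop
    have : (1 : R) ∈ I := htop ▸ Submodule.mem_top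
    rw [hI, LinearMap.mem_ker] at this
    simp at this
    exact hm this
  have hg : I ≤ LinearMap.ker (LinearMap.toSpanSingleton R E e₀) := by
    intro r hr
    rw [LinearMap.mem_ker]
    simpa using h.kill r (hIm hr)
  obtain ⟨f, hf⟩ := h.baer.extension_property
    (I.liftQ (LinearMap.toSpanSingleton R M m) le_rfl)
    (LinearMap.ker_eq_bot.mp (Submodule.ker_liftQ_eq_bot _ _ _ le_rfl))
    (I.liftQ (LinearMap.toSpanSingleton R E e₀) hg)
  refine ⟨f, ?_⟩
  have := LinearMap.congr_fun hf (Submodule.Quotient.mk 1)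
  simp only [LinearMap.comp_apply, Submodule.liftQ_apply, LinearMap.toSpanSingleton_apply,
    one_smul] at this
  rw [this]
  exact h.ne

theorem Hull.cog_sub (h : Hull R E e₀) {M : Type*} [AddCommGroup M] [Module R M]
    (N : Submodule R M) {m : M} (hm : m ∉ N) :
    ∃ f : M →ₗ[R] E, (∀ n ∈ N, f n = 0) ∧ f m ≠ 0 := by
  obtain ⟨f, hf⟩ := h.cog (m := N.mkQ m) (by simpa using hm)
  refine ⟨f.comp N.mkQ, fun n hn => ?_, hf⟩
  have hn0 : N.mkQ n = 0 := by simpa using hn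
  rw [LinearMap.comp_apply, hn0, map_zero]

theorem Hull.soc (h : Hull R E e₀) (x : E) (hx : ∀ r ∈ maximalIdeal R, r • x = 0) :
    ∃ c : R, x = c • e₀ := by
  by_cases hx0 : x = 0
  · exact ⟨0, by simp [hx0]⟩
  · have := h.ess (Submodule.span R {x}) (by simpa using hx0)
    obtain ⟨r, hr⟩ := Submodule.mem_span_singleton.mp this
    have hu : IsUnit r := by
      by_contra hu
      exact h.ne (by rw [← hr, hx r ((mem_maximalIdeal r).mpr hu)])
    obtain ⟨u, rfl⟩ := hu
    refine ⟨((u⁻¹ : Rˣ) : R), ?_⟩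
    rw [← hr, smul_smul]
    simp

/-- the embedding of the residue field -/
noncomputable def Hull.emb (h : Hull R E e₀) : (R ⧸ maximalIdeal R) →ₗ[R] E :=
  Submodule.liftQ (maximalIdeal R) (LinearMap.toSpanSingleton R E e₀) (by
    intro r hr
    rw [LinearMap.mem_ker]
    simpa using h.kill r hr)

theorem Hull.emb_mk (h : Hull R E e₀) (r : R) :
    h.emb (Submodule.Quotient.mk r) = r • e₀ := rfl

theorem Hull.emb_inj (h : Hull R E e₀) : Function.Injective h.emb := by
  apply LinearMap.ker_eq_bot.mp
  apply Submodule.ker_liftQ_eq_bot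
  intro r hr
  rw [LinearMap.mem_ker, LinearMap.toSpanSingleton_apply] at hr
  rw [mem_maximalIdeal, mem_nonunits_iff]
  rintro ⟨u, rfl⟩
  apply h.ne
  have : ((u⁻¹ : Rˣ) : R) • ((u : R) • e₀) = 0 := by rw [hr, smul_zero]
  simpa [smul_smul] using this

theorem Hull.rfl_k (h : Hull R E e₀) : Rfl R E (R ⧸ maximalIdeal R) := by
  intro φ
  have hk : ∀ (z : R ⧸ maximalIdeal R), ∀ r ∈ maximalIdeal R, r • z = 0 := by
    intro z r hr
    obtain ⟨s, rfl⟩ := Submodule.Quotient.mk_surjective _ z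
    rw [← Submodule.Quotient.mk_smul, Submodule.Quotient.mk_eq_zero]
    exact Ideal.mul_mem_right _ _ hr
  obtain ⟨d, hd⟩ := h.soc (φ h.emb) (by
    intro r hr
    rw [← map_smul]
    have : r • h.emb = 0 := by
      ext1
      ext1
      rw [LinearMap.comp_apply, LinearMap.smul_apply, ← map_smul, hk _ r hr]
      simp
    rw [this, map_zero])
  refine ⟨Submodule.Quotient.mk d, fun f => ?_⟩
  obtain ⟨c, hc⟩ := h.soc (f (Submodule.Quotient.mk 1)) (by
    intro r hr
    rw [← map_smul, hk _ r hr, map_zero])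
  have hf : ∀ r : R, f (Submodule.Quotient.mk r) = r • c • e₀ := by
    intro r
    rw [← hc, ← map_smul, ← Submodule.Quotient.mk_smul]
    simp
  have : f = c • h.emb := by
    apply LinearMap.ext
    intro z
    obtain ⟨s, rfl⟩ := Submodule.Quotient.mk_surjective _ z
    rw [hf, LinearMap.smul_apply, h.emb_mk, smul_comm]
  rw [hf, this, map_smul, hd, smul_comm]

theorem Hull.rfl_quot (h : Hull R E e₀) {M M' : Type*} [AddCommGroup M] [Module R M]
    [AddCommGroup M'] [Module R M'] (p : M →ₗ[R] M') (hp : Function.Surjective p)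
    (hM : Rfl R E M) : Rfl R E M' := by
  intro φ
  obtain ⟨ψ, hψ⟩ := h.baer.extension_property
    (LinearMap.lcomp R E p : (M' →ₗ[R] E) →ₗ[R] (M →ₗ[R] E))
    (by
      intro f g hfg
      ext x
      obtain ⟨y, rfl⟩ := hp x
      exact LinearMap.congr_fun hfg y) φ
  obtain ⟨m, hm⟩ := hM ψ
  refine ⟨p m, fun f => ?_⟩
  rw [← hψ, LinearMap.comp_apply, hm]
  rfl

theorem Hull.rfl_sub (h : Hull R E e₀) {M M' : Type*} [AddCommGroup M] [Module R M]
    [AddCommGroup M'] [Module R M'] (j : M →ₗ[R] M') (hj : Function.Injective j)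
    (hM : Rfl R E M') : Rfl R E M := by
  intro φ
  obtain ⟨m', hm'⟩ := hM (φ.comp (LinearMap.lcomp R E j : (M' →ₗ[R] E) →ₗ[R] (M →ₗ[R] E)))
  have : m' ∈ LinearMap.range j := by
    by_contra hcon
    obtain ⟨g, hg, hgm⟩ := h.cog_sub _ hcon
    apply hgm
    rw [← hm', LinearMap.comp_apply]
    have : LinearMap.lcomp R E j g = 0 := by
      ext x
      exact hg _ ⟨x, rfl⟩
    rw [this, map_zero]
  obtain ⟨m, rfl⟩ := this
  refine ⟨m, fun f => ?_⟩
  obtain ⟨g, rfl⟩ := h.baer.extension_property j hj f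
  exact hm' g

theorem Hull.rfl_ext (h : Hull R E e₀) {M : Type*} [AddCommGroup M] [Module R M]
    (N : Submodule R M) (hN : Rfl R E N) (hQ : Rfl R E (M ⧸ N)) : Rfl R E M := by
  intro φ
  obtain ⟨q, hq⟩ := hQ (φ.comp (LinearMap.lcomp R E N.mkQ))
  obtain ⟨m, rfl⟩ := N.mkQ_surjective q
  let ρ : (M →ₗ[R] E) →ₗ[R] (N →ₗ[R] E) := LinearMap.lcomp R E N.subtype
  have hρ : Function.Surjective ρ := by
    intro f
    obtain ⟨g, hg⟩ := h.baer.extension_property N.subtype N.injective_subtype f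
    exact ⟨g, hg⟩
  let φ' : (M →ₗ[R] E) →ₗ[R] E := φ - LinearMap.applyₗ m
  have hker : LinearMap.ker ρ ≤ LinearMap.ker φ' := by
    intro f hf
    rw [LinearMap.mem_ker] at hf ⊢
    have hfN : N ≤ LinearMap.ker f := by
      intro n hn
      exact LinearMap.congr_fun hf ⟨n, hn⟩
    have := hq (N.liftQ f hfN)
    have h2 : LinearMap.lcomp R E N.mkQ (N.liftQ f hfN) = f := N.liftQ_mkQ f hfN
    rw [LinearMap.comp_apply, h2] at this
    simp [φ', this]
  let ψ : (N →ₗ[R] E) →ₗ[R] E :=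
    ((LinearMap.ker ρ).liftQ φ' hker).comp (ρ.quotKerEquivOfSurjective hρ).symm.toLinearMap
  have hψ : ∀ f, ψ (ρ f) = φ' f := by
    intro f
    have : (ρ.quotKerEquivOfSurjective hρ).symm (ρ f) = Submodule.Quotient.mk f := by
      rw [LinearEquiv.symm_apply_eq]
      rfl
    simp [ψ, this]
  obtain ⟨n, hn⟩ := hN ψ
  refine ⟨m + n, fun f => ?_⟩
  have h1 := hψ f
  rw [hn] at h1
  have h2 : ρ f n = f n := rfl
  rw [h2] at h1
  simp only [φ', LinearMap.sub_apply, LinearMap.applyₗ_apply_apply] at h1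
  rw [map_add, h1]
  abel

theorem rfl_pi {n : ℕ} {A : Type*} [AddCommGroup A] [Module R A] (hA : Rfl R E A) :
    Rfl R E (Fin n → A) := by
  intro φ
  have : ∀ i : Fin n, ∃ a : A, ∀ g : A →ₗ[R] E,
      φ (g.comp (LinearMap.proj i)) = g a := fun i =>
    hA (φ.comp (LinearMap.lcomp R E (LinearMap.proj i : (Fin n → A) →ₗ[R] A)))
  choose a ha using this
  refine ⟨a, fun f => ?_⟩
  have hf : f = ∑ i, (f.comp (LinearMap.single R (fun _ => A) i)).comp (LinearMap.proj i) := by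
    apply LinearMap.ext
    intro x
    rw [LinearMap.sum_apply]
    simp only [LinearMap.comp_apply, LinearMap.proj_apply, LinearMap.single_apply]
    rw [← map_sum, Finset.univ_sum_single]
  conv_lhs => rw [hf]
  conv_rhs => rw [hf]
  rw [map_sum, LinearMap.sum_apply]
  refine Finset.sum_congr rfl fun i _ => ?_
  rw [ha]
  rfl

theorem Hull.rfl_kill (h : Hull R E e₀) {M : Type*} [AddCommGroup M] [Module R M]
    [Module.Finite R M] (hM : ∀ r ∈ maximalIdeal R, ∀ x : M, r • x = 0) : Rfl R E M := by
  have hT : Module.IsTorsionBySet R M (maximalIdeal R : Set R) := fun x r => hM r r.2 x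
  let := hT.module
  have : IsScalarTower R (R ⧸ maximalIdeal R) M := hT.isScalarTower
  have : Module.Finite (R ⧸ maximalIdeal R) M := Module.Finite.of_restrictScalars_finite R _ _
  obtain ⟨n, f, hf⟩ := Module.Finite.exists_fin' (R ⧸ maximalIdeal R) M
  exact h.rfl_quot (f.restrictScalars R) hf (rfl_pi h.rfl_k)

theorem Hull.rfl_pow [IsNoetherianRing R] (h : Hull R E e₀) (n : ℕ) :
    ∀ {M : Type w} [AddCommGroup M] [Module R M]
    [Module.Finite R M] (_ : ∀ r ∈ maximalIdeal R ^ n, ∀ x : M, r • x = 0), Rfl R E M := by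
  induction n with
  | zero =>
    intro M _ _ _ hM φ
    refine ⟨0, fun f => ?_⟩
    have : f = 0 := by
      ext x
      have := hM 1 (by simp) x
      rw [one_smul] at this
      simp [this]
    simp [this]
  | succ n ih =>
    intro M _ _ _ hM
    refine h.rfl_ext (maximalIdeal R • ⊤) (ih ?_) (h.rfl_kill ?_)
    · rintro r hr ⟨x, hx⟩
      ext
      change r • x = 0
      induction hx using Submodule.smul_induction_on' with
      | smul s hs y _ =>
        rw [smul_smul]
        exact hM _ (by rw [pow_succ]; exact Ideal.mul_mem_mul hr hs) y
      | add x _ y _ hx hy => rw [smul_add, hx, hy, add_zero]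
    · intro r hr x
      obtain ⟨y, rfl⟩ := Submodule.Quotient.mk_surjective _ x
      rw [← Submodule.Quotient.mk_smul, Submodule.Quotient.mk_eq_zero]
      exact Submodule.smul_mem_smul hr Submodule.mem_top

theorem artin_rees [IsNoetherianRing R] {M : Type*} [AddCommGroup M] [Module R M]
    (S S' : Submodule R M) (hS' : S'.FG) (hle : S ≤ S') :
    ∃ k, ∀ a, (maximalIdeal R ^ (a + k) • S') ⊓ S ≤ maximalIdeal R ^ a • S := by
  have : Module.Finite R S' := Module.Finite.iff_fg.mpr hS'
  obtain ⟨k, hk⟩ := Ideal.exists_pow_inf_eq_pow_smul (maximalIdeal R) (S.comap S'.subtype)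
  refine ⟨k, fun a => ?_⟩
  have h1 := hk (a + k) (by omega)
  rw [Nat.add_sub_cancel] at h1
  have h2 : maximalIdeal R ^ (a + k) • (⊤ : Submodule R S') ⊓ S.comap S'.subtype ≤
      maximalIdeal R ^ a • S.comap S'.subtype := h1.le.trans (Submodule.smul_mono le_rfl inf_le_right)
  have h3 := Submodule.map_mono (f := S'.subtype) h2
  rw [Submodule.map_inf _ S'.injective_subtype, Submodule.map_smul'', Submodule.map_smul'',
    Submodule.map_comap_subtype, Submodule.map_top, Submodule.range_subtype,
    inf_eq_right.mpr hle] at h3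
  exact h3

theorem Hull.torsion [IsNoetherianRing R] (h : Hull R E e₀) (x : E) :
    ∃ n, ∀ r ∈ maximalIdeal R ^ n, r • x = 0 := by
  by_cases hx : x = 0
  · exact ⟨0, by simp [hx]⟩
  have he : e₀ ∈ Submodule.span R {x} := h.ess _ (by simpa using hx)
  obtain ⟨k, hk⟩ := artin_rees (R := R) (Submodule.span R {e₀}) (Submodule.span R {x})
    (Submodule.fg_span_singleton x) (by simpa using he)
  have h1 := hk 1
  refine ⟨1 + k, fun r hr => ?_⟩
  by_contra hrx
  have hmem : r • x ∈ maximalIdeal R ^ (1 + k) • Submodule.span R {x} :=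
    Submodule.smul_mem_smul hr (Submodule.mem_span_singleton_self x)
  have h2 : e₀ ∈ maximalIdeal R ^ (1 + k) • Submodule.span R {x} := by
    apply h.ess
    intro hb
    rw [hb] at hmem
    exact hrx (by simpa using hmem)
  have h3 := h1 ⟨h2, Submodule.mem_span_singleton_self _⟩
  have h4 : maximalIdeal R ^ 1 • Submodule.span R {e₀} ≤ ⊥ := by
    rw [pow_one, Submodule.smul_le]
    intro r hr n hn
    obtain ⟨c, rfl⟩ := Submodule.mem_span_singleton.mp hn
    rw [smul_comm, h.kill r hr]
    simp
  exact h.ne (by simpa using h4 h3)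

theorem Hull.rfl_R [IsNoetherianRing R] [IsAdicComplete (maximalIdeal R) R] (h : Hull R E e₀) :
    Rfl R E R := by
  intro φ
  have hn : ∀ n : ℕ, Rfl R E (R ⧸ maximalIdeal R ^ n) := by
    intro n
    apply h.rfl_pow n
    intro r hr x
    obtain ⟨y, rfl⟩ := Submodule.Quotient.mk_surjective _ x
    rw [← Submodule.Quotient.mk_smul, Submodule.Quotient.mk_eq_zero]
    exact Ideal.mul_mem_right _ _ hr
  have hr : ∀ n : ℕ, ∃ r : R, ∀ f : R →ₗ[R] E, (∀ s ∈ maximalIdeal R ^ n, f s = 0) →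
      φ f = f r := by
    intro n
    obtain ⟨q, hq⟩ := hn n (φ.comp (LinearMap.lcomp R E (Submodule.mkQ (maximalIdeal R ^ n))))
    obtain ⟨r, rfl⟩ := Submodule.mkQ_surjective _ q
    refine ⟨r, fun f hf => ?_⟩
    have := hq (Submodule.liftQ _ f hf)
    have h2 : LinearMap.lcomp R E (Submodule.mkQ (maximalIdeal R ^ n))
      (Submodule.liftQ _ f hf) = f := Submodule.liftQ_mkQ _ f hf
    rw [LinearMap.comp_apply, h2] at this
    exact this
  choose r hr using hr
  obtain ⟨L, hL⟩ := IsPrecomplete.prec' (I := maximalIdeal R) r (by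
    intro m n hmn
    rw [SModEq.sub_mem]
    simp only [smul_eq_mul, Ideal.mul_top]
    by_contra hcon
    obtain ⟨f, hf, hne⟩ := h.cog_sub (maximalIdeal R ^ m) hcon
    apply hne
    rw [map_sub, ← hr m f hf, ← hr n f (fun s hs => hf s (Ideal.pow_le_pow_right hmn hs)), sub_self])
  refine ⟨L, fun f => ?_⟩
  obtain ⟨n, hn⟩ := h.torsion (f 1)
  have hf : ∀ s ∈ maximalIdeal R ^ n, f s = 0 := by
    intro s hs
    rw [← hn s hs, ← map_smul]
    simp
  have h1 := hL n
  rw [SModEq.sub_mem] at h1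
  simp only [smul_eq_mul, Ideal.mul_top] at h1
  have h2 := hf _ h1
  rw [map_sub, sub_eq_zero] at h2
  rw [hr n f hf, h2]

theorem Hull.end_smul [IsNoetherianRing R] [IsAdicComplete (maximalIdeal R) R] (h : Hull R E e₀)
    (f : E →ₗ[R] E) : ∃ r : R, ∀ x, f x = r • x := by
  obtain ⟨r, hr⟩ := h.rfl_R (f.comp (LinearMap.applyₗ (1 : R)))
  refine ⟨r, fun x => ?_⟩
  have := hr (LinearMap.toSpanSingleton R E x)
  simpa using this

theorem Hull.rfl_E [IsNoetherianRing R] [IsAdicComplete (maximalIdeal R) R] (h : Hull R E e₀) :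
    Rfl R E E := by
  intro φ
  refine ⟨φ LinearMap.id, fun f => ?_⟩
  obtain ⟨r, hr⟩ := h.end_smul f
  have : f = r • LinearMap.id := by
    ext x
    simp [hr]
  rw [hr, ← map_smul, ← this]

theorem Hull.artinian_E [IsNoetherianRing R] [IsAdicComplete (maximalIdeal R) R]
    (h : Hull R E e₀) : IsArtinian R E := by
  have hanti : ∀ X Y : Submodule R E, X < Y → Y.annihilator < X.annihilator := by
    intro X Y hXY
    refine lt_of_le_of_ne (Submodule.annihilator_mono hXY.le) ?_
    intro heq
    obtain ⟨y, hy, hyX⟩ := SetLike.exists_of_lt hXY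
    obtain ⟨f, hf, hfy⟩ := h.cog_sub X hyX
    obtain ⟨r, hr⟩ := h.end_smul f
    have h1 : r ∈ X.annihilator := by
      rw [Submodule.mem_annihilator]
      intro n hn
      rw [← hr, hf n hn]
    rw [← heq, Submodule.mem_annihilator] at h1
    exact hfy (by rw [hr, h1 y hy])
  have hwf : WellFounded (fun I J : Ideal R => J < I) := wellFounded_gt
  exact ⟨Subrelation.wf (fun {X Y} hXY => hanti X Y hXY)
    (InvImage.wf (fun X : Submodule R E => X.annihilator) hwf)⟩

theorem Hull.embed_of_artinian (h : Hull R E e₀) (M : Type*) [AddCommGroup M] [Module R M]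
    [IsArtinian R M] : ∃ (n : ℕ) (j : M →ₗ[R] (Fin n → E)), Function.Injective j := by
  obtain ⟨K, ⟨n, j, rfl⟩, hmin⟩ := IsArtinian.set_has_minimal
    {K : Submodule R M | ∃ (n : ℕ) (j : M →ₗ[R] (Fin n → E)), K = LinearMap.ker j}
    ⟨_, 0, 0, rfl⟩
  refine ⟨n, j, LinearMap.ker_eq_bot.mp ?_⟩
  by_contra hne
  obtain ⟨x, hx, hx0⟩ := Submodule.exists_mem_ne_zero_of_ne_bot hne
  obtain ⟨f, hf⟩ := h.cog hx0
  let j' : M →ₗ[R] (Fin (n + 1) → E) :=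
    LinearMap.pi (Fin.cons f (fun i => (LinearMap.proj i).comp j))
  have hj0 : ∀ y, j' y 0 = f y := fun y => rfl
  have hjs : ∀ y i, j' y (Fin.succ i) = j y i := fun y i => rfl
  refine hmin (LinearMap.ker j') ⟨n + 1, j', rfl⟩ (lt_of_le_of_ne ?_ ?_)
  · intro y hy
    rw [LinearMap.mem_ker] at hy ⊢
    ext i
    rw [← hjs, hy]
    rfl
  · intro heq
    rw [← heq, LinearMap.mem_ker] at hx
    apply hf
    rw [← hj0, hx]
    rfl

theorem Hull.rfl_of_minimax [IsNoetherianRing R] [IsAdicComplete (maximalIdeal R) R]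
    (h : Hull R E e₀) {M : Type*} [AddCommGroup M] [Module R M] (N : Submodule R M)
    (hN : N.FG) (hA : IsArtinian R (M ⧸ N)) : Rfl R E M := by
  apply h.rfl_ext N
  · have : Module.Finite R N := Module.Finite.iff_fg.mpr hN
    obtain ⟨n, f, hf⟩ := Module.Finite.exists_fin' R N
    exact h.rfl_quot f hf (rfl_pi h.rfl_R)
  · obtain ⟨n, j, hj⟩ := h.embed_of_artinian (M ⧸ N)
    exact h.rfl_sub j hj (rfl_pi h.rfl_E)

theorem Hull.finite_index (h : Hull R E e₀) (I : Type*)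
    (hr : Rfl R E (I →₀ (R ⧸ maximalIdeal R))) : Finite I := by
  by_contra hinf
  rw [not_finite_iff_infinite] at hinf
  let A : Submodule R ((I →₀ (R ⧸ maximalIdeal R)) →ₗ[R] E) :=
    { carrier := {f | {i | f (Finsupp.single i (Submodule.Quotient.mk 1)) ≠ 0}.Finite}
      zero_mem' := by simp
      add_mem' := by
        intro f g hf hg
        refine (Set.Finite.union hf hg).subset ?_
        intro i hi
        by_contra hcon
        simp only [Set.mem_union, Set.mem_ofPred_eq, not_or, not_not] at hcon
        exact hi (by rw [LinearMap.add_apply, hcon.1, hcon.2, add_zero])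
      smul_mem' := by
        intro c f hf
        refine Set.Finite.subset hf ?_
        intro i hi hcon
        exact hi (by rw [LinearMap.smul_apply, hcon, smul_zero]) }
  let g : (I →₀ (R ⧸ maximalIdeal R)) →ₗ[R] E := Finsupp.lsum R (fun _ => h.emb)
  have hg : g ∉ A := by
    intro hg
    have hall : {i : I | g (Finsupp.single i (Submodule.Quotient.mk 1)) ≠ 0} = Set.univ := by
      apply Set.eq_univ_of_forall
      intro i
      simp only [g, Set.mem_ofPred_eq, Finsupp.lsum_single, h.emb_mk, one_smul]
      exact h.ne
    have hg' : {i : I | g (Finsupp.single i (Submodule.Quotient.mk 1)) ≠ 0}.Finite := hg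
    rw [hall] at hg'
    exact Set.infinite_univ hg'
  obtain ⟨φ, hφ, hφg⟩ := h.cog_sub A hg
  obtain ⟨v, hv⟩ := hr φ
  have hv0 : v = 0 := by
    ext i
    let f : (I →₀ (R ⧸ maximalIdeal R)) →ₗ[R] E := h.emb.comp (Finsupp.lapply i)
    have hfA : f ∈ A := by
      refine (Set.finite_singleton i).subset ?_
      intro j hj
      by_contra hne
      apply hj
      have hne' : j ≠ i := hne
      simp [f, Finsupp.single_apply, hne']
    have h1 := hφ f hfA
    rw [hv] at h1
    apply h.emb_inj
    rw [Finsupp.zero_apply, map_zero]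
    exact h1
  apply hφg
  rw [hv, hv0, map_zero]

theorem Hull.finite_socle (h : Hull R E e₀) {V : Type*} [AddCommGroup V] [Module R V]
    (hV : ∀ r ∈ maximalIdeal R, ∀ x : V, r • x = 0) (hr : Rfl R E V) : Module.Finite R V := by
  have hT : Module.IsTorsionBySet R V (maximalIdeal R : Set R) := fun x r => hV r r.2 x
  let := hT.module
  have : IsScalarTower R (R ⧸ maximalIdeal R) V := hT.isScalarTower
  let : Field (R ⧸ maximalIdeal R) := Ideal.Quotient.field _
  let b := Module.Free.chooseBasis (R ⧸ maximalIdeal R) V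
  have hfin := h.finite_index _
    (h.rfl_quot (b.repr.restrictScalars R).toLinearMap (b.repr.restrictScalars R).surjective hr)
  have : Module.Finite (R ⧸ maximalIdeal R) V := Module.Finite.of_basis b
  exact Module.Finite.trans (R ⧸ maximalIdeal R) V

/-- The socle of a reflexive module is noetherian. -/
theorem Hull.noeth_socle [IsNoetherianRing R] (h : Hull R E e₀) {V : Type*} [AddCommGroup V]
    [Module R V] (hr : Rfl R E V) :
    IsNoetherian R (Submodule.torsionBySet R V (maximalIdeal R : Set R)) ∧
    IsArtinian R (Submodule.torsionBySet R V (maximalIdeal R : Set R)) := by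
  have hV : ∀ r ∈ maximalIdeal R, ∀ x : Submodule.torsionBySet R V (maximalIdeal R : Set R),
      r • x = 0 := by
    rintro r hr ⟨x, hx⟩
    ext
    exact (Submodule.mem_torsionBySet_iff _ _).mp hx ⟨r, hr⟩
  have := h.finite_socle hV (h.rfl_sub _ (Submodule.injective_subtype _) hr)
  refine ⟨inferInstance, ?_⟩
  have hT : Module.IsTorsionBySet R (Submodule.torsionBySet R V (maximalIdeal R : Set R))
    (maximalIdeal R : Set R) := fun x r => hV r r.2 x
  let := hT.module
  have : IsScalarTower R (R ⧸ maximalIdeal R)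
    (Submodule.torsionBySet R V (maximalIdeal R : Set R)) := hT.isScalarTower
  let : Field (R ⧸ maximalIdeal R) := Ideal.Quotient.field _
  have : Module.Finite (R ⧸ maximalIdeal R)
    (Submodule.torsionBySet R V (maximalIdeal R : Set R)) :=
    Module.Finite.of_restrictScalars_finite R _ _
  have : IsArtinian (R ⧸ maximalIdeal R)
    (Submodule.torsionBySet R V (maximalIdeal R : Set R)) := inferInstance
  exact (isArtinian_of_surjective_algebraMap (S := R) (R := R ⧸ maximalIdeal R)
    Ideal.Quotient.mk_surjective)

theorem Hull.artinian_of_torsion [IsNoetherianRing R] [IsAdicComplete (maximalIdeal R) R]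
    (h : Hull R E e₀) {M : Type*} [AddCommGroup M] [Module R M] (hr : Rfl R E M)
    (htor : ∀ x : M, ∃ n, ∀ r ∈ maximalIdeal R ^ n, r • x = 0) : IsArtinian R M := by
  have hVA := (h.noeth_socle hr).2
  set V := Submodule.torsionBySet R M (maximalIdeal R : Set R) with hV
  obtain ⟨n, j, hj⟩ := h.embed_of_artinian V
  have hF : ∀ i : Fin n, ∃ F : M →ₗ[R] E, F.comp V.subtype = (LinearMap.proj i).comp j :=
    fun i => h.baer.extension_property V.subtype V.injective_subtype _
  choose F hF using hF
  have := h.artinian_E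
  refine isArtinian_of_injective (LinearMap.pi F) (LinearMap.ker_eq_bot.mp ?_)
  by_contra hne
  obtain ⟨x, hx, hx0⟩ := Submodule.exists_mem_ne_zero_of_ne_bot hne
  classical
  have hfind := Nat.find_spec (htor x)
  have hmin := fun m => Nat.find_min (htor x) (m := m)
  generalize Nat.find (htor x) = a at hfind hmin
  cases a with
  | zero => exact hx0 (by simpa using hfind 1 (by simp))
  | succ a =>
    have h1 := hmin a (Nat.lt_succ_self a)
    push Not at h1
    obtain ⟨r, hr, hrx⟩ := h1
    have hy : r • x ∈ V := by
      rw [hV, Submodule.mem_torsionBySet_iff]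
      rintro ⟨s, hs⟩
      change s • r • x = 0
      rw [smul_smul]
      exact hfind _ (by rw [pow_succ']; exact Ideal.mul_mem_mul hs hr)
    have hjy : j ⟨r • x, hy⟩ = j 0 := by
      rw [map_zero]
      ext i
      have h2 := LinearMap.congr_fun (hF i) ⟨r • x, hy⟩
      have h3 : F i x = 0 := congrFun (LinearMap.mem_ker.mp hx) i
      have h4 : F i (r • x) = j ⟨r • x, hy⟩ i := h2
      rw [← h4, map_smul, h3, smul_zero]
      rfl
    exact hrx (congrArg Subtype.val (hj hjy))

theorem chain_step [IsNoetherianRing R] {M : Type*} [AddCommGroup M] [Module R M]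
    (hno : ∀ S : Submodule R M, S.FG → ∃ x : M, ∀ n, ∃ r ∈ maximalIdeal R ^ n, r • x ∉ S)
    (S N : Submodule R M) (hS : S.FG) (hNS : N ≤ S) (a : ℕ) (ha : maximalIdeal R ^ a • S ≤ N) :
    ∃ S' N' : Submodule R M, (S'.FG ∧ N' ≤ S' ∧ ∃ b, maximalIdeal R ^ b • S' ≤ N') ∧
      S ≤ S' ∧ N ≤ N' ∧ N' ⊓ S ≤ N ∧
      ∃ y ∈ S', (∀ r ∈ maximalIdeal R, r • y ∈ N') ∧ y ∉ S ⊔ N' := by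
  obtain ⟨x, hx⟩ := hno S hS
  set S' := S ⊔ Submodule.span R {x} with hS'
  have hS'fg : S'.FG := hS.sup (Submodule.fg_span_singleton x)
  have hSS' : S ≤ S' := le_sup_left
  obtain ⟨k, hk⟩ := artin_rees S S' hS'fg hSS'
  refine ⟨S', N ⊔ maximalIdeal R ^ (a + 1 + k) • S', ⟨hS'fg, ?_, a + 1 + k, le_sup_right⟩,
    hSS', le_sup_left, ?_, ?_⟩
  · exact sup_le (hNS.trans hSS') Submodule.smul_le_right
  · rw [sup_inf_assoc_of_le _ hNS]
    refine sup_le le_rfl ((hk (a + 1)).trans (le_trans ?_ ha))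
    exact Submodule.smul_mono (Ideal.pow_le_pow_right (Nat.le_succ a)) le_rfl
  · by_contra hcon
    push Not at hcon
    have hle : maximalIdeal R ^ (a + k) • S' ≤ S := by
      apply Submodule.le_of_le_smul_of_le_jacobson_bot (I := maximalIdeal R)
      · exact Submodule.FG.smul (IsNoetherian.noetherian _) hS'fg
      · exact (IsLocalRing.jacobson_eq_maximalIdeal ⊥ bot_ne_top).ge
      · have hpow : maximalIdeal R • maximalIdeal R ^ (a + k) • S' =
            maximalIdeal R ^ (a + 1 + k) • S' := by
          rw [← Submodule.mul_smul, ← pow_succ']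
          congr 2
          omega
        rw [hpow]
        intro y hy
        have hyS : y ∈ S' := Submodule.smul_le_right hy
        have := hcon y hyS (by
          intro r hr
          apply Submodule.mem_sup_right
          rw [← hpow]
          exact Submodule.smul_mem_smul hr hy)
        rwa [← sup_assoc, sup_eq_left.mpr hNS] at this
    obtain ⟨r, hr, hrx⟩ := hx (a + k)
    exact hrx (hle (Submodule.smul_mem_smul hr
      (Submodule.mem_sup_right (Submodule.mem_span_singleton_self x))))

theorem Hull.exists_fg [IsNoetherianRing R] (h : Hull R E e₀) {M : Type*} [AddCommGroup M]
    [Module R M] (hM : Rfl R E M) :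
    ∃ S : Submodule R M, S.FG ∧ ∀ x : M, ∃ n, ∀ r ∈ maximalIdeal R ^ n, r • x ∈ S := by
  by_contra hno
  push Not at hno
  let P : Submodule R M × Submodule R M → Prop := fun p =>
    p.1.FG ∧ p.2 ≤ p.1 ∧ ∃ b, maximalIdeal R ^ b • p.1 ≤ p.2
  have step : ∀ p : {p // P p}, ∃ q : {p // P p}, p.1.1 ≤ q.1.1 ∧ p.1.2 ≤ q.1.2 ∧
      q.1.2 ⊓ p.1.1 ≤ p.1.2 ∧
      ∃ y ∈ q.1.1, (∀ r ∈ maximalIdeal R, r • y ∈ q.1.2) ∧ y ∉ p.1.1 ⊔ q.1.2 := by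
    rintro ⟨⟨S, N⟩, hS, hNS, a, ha⟩
    obtain ⟨S', N', hP, hrest⟩ := chain_step hno S N hS hNS a ha
    exact ⟨⟨⟨S', N'⟩, hP⟩, hrest⟩
  choose nxt h1 h2 h3 h4 using step
  let p0 : {p // P p} := ⟨(⊥, ⊥), Submodule.fg_bot, le_rfl, 0, by simp⟩
  let p : ℕ → {p // P p} := fun n => Nat.rec p0 (fun _ q => nxt q) n
  have hp : ∀ n, p (n + 1) = nxt (p n) := fun n => rfl
  let S : ℕ →o Submodule R M := ⟨fun n => (p n).1.1, monotone_nat_of_le_succ fun n => h1 (p n)⟩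
  let N : ℕ →o Submodule R M := ⟨fun n => (p n).1.2, monotone_nat_of_le_succ fun n => h2 (p n)⟩
  have hNS : ∀ i j, N (i + j) ⊓ S i ≤ N i := by
    intro i j
    induction j with
    | zero => exact inf_le_left
    | succ j ih =>
      refine le_trans (le_inf ?_ inf_le_right) ih
      refine le_trans (le_inf inf_le_left (inf_le_right.trans ?_)) (h3 (p (i + j)))
      exact S.monotone (Nat.le_add_right i j)
  let L : Submodule R M := ⨆ i, N i
  have hL : ∀ i, L ⊓ S i ≤ N i := by
    rintro i x ⟨hxL, hxS⟩
    obtain ⟨k, hk⟩ := (Submodule.mem_iSup_of_chain N x).mp hxL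
    exact hNS i k ⟨N.monotone (Nat.le_add_left k i) hk, hxS⟩
  have hnoeth := (h.noeth_socle (h.rfl_quot L.mkQ L.mkQ_surjective hM)).1
  set V := Submodule.torsionBySet R (M ⧸ L) (maximalIdeal R : Set R) with hV
  let K : ℕ →o Submodule R V :=
    ⟨fun n => ((S n).map L.mkQ).comap V.subtype, fun i j hij =>
      Submodule.comap_mono (Submodule.map_mono (S.monotone hij))⟩
  obtain ⟨n, hn⟩ := monotone_stabilizes_iff_noetherian.mpr hnoeth K
  obtain ⟨y, hyS, hyN, hy⟩ := h4 (p n)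
  have hNL : N (n + 1) ≤ L := le_iSup N (n + 1)
  have hyV : L.mkQ y ∈ V := by
    rw [hV, Submodule.mem_torsionBySet_iff]
    rintro ⟨r, hr⟩
    change r • L.mkQ y = 0
    rw [← map_smul, Submodule.mkQ_apply, Submodule.Quotient.mk_eq_zero]
    exact hNL (hyN r hr)
  have hyK : (⟨L.mkQ y, hyV⟩ : V) ∈ K (n + 1) := ⟨y, hyS, rfl⟩
  rw [← hn (n + 1) (Nat.le_succ n)] at hyK
  obtain ⟨s, hs, hsy⟩ := hyK
  have hd : y - s ∈ L := by
    rw [← Submodule.Quotient.mk_eq_zero, Submodule.Quotient.mk_sub, sub_eq_zero]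
    exact hsy.symm
  have hd2 : y - s ∈ N (n + 1) :=
    hL (n + 1) ⟨hd, Submodule.sub_mem _ hyS (S.monotone (Nat.le_succ n) hs)⟩
  apply hy
  have : y = s + (y - s) := by abel
  rw [this]
  exact Submodule.add_mem_sup hs hd2

theorem Hull.minimax_of_rfl [IsNoetherianRing R] [IsAdicComplete (maximalIdeal R) R]
    (h : Hull R E e₀) {M : Type*} [AddCommGroup M] [Module R M] (hM : Rfl R E M) :
    ∃ N : Submodule R M, N.FG ∧ IsArtinian R (M ⧸ N) := by
  obtain ⟨S, hS, htor⟩ := h.exists_fg hM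
  refine ⟨S, hS, h.artinian_of_torsion (h.rfl_quot S.mkQ S.mkQ_surjective hM) ?_⟩
  intro x
  obtain ⟨y, rfl⟩ := S.mkQ_surjective x
  obtain ⟨n, hn⟩ := htor y
  refine ⟨n, fun r hr => ?_⟩
  rw [← map_smul, Submodule.mkQ_apply, Submodule.Quotient.mk_eq_zero]
  exact hn r hr

end

/-- A complete noetherian local ring is as small as its residue field allows. -/
theorem small_ring (R : Type u) [CommRing R] [IsNoetherianRing R] [IsLocalRing R]
    [IsAdicComplete (maximalIdeal R) R] [Small.{v} (R ⧸ maximalIdeal R)] : Small.{v} R := by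
  have hsm : ∀ n : ℕ, Small.{v} (R ⧸ maximalIdeal R ^ n) := by
    intro n
    induction n with
    | zero =>
      have : Subsingleton (R ⧸ maximalIdeal R ^ 0) := by
        rw [pow_zero, Ideal.one_eq_top]
        infer_instance
      infer_instance
    | succ n ih =>
      obtain ⟨k, g, hg⟩ := Submodule.fg_iff_exists_fin_generating_family.mp
        (IsNoetherian.noetherian (maximalIdeal R ^ n))
      let F : (R ⧸ maximalIdeal R ^ n) × (Fin k → R ⧸ maximalIdeal R) →
          R ⧸ maximalIdeal R ^ (n + 1) := fun p =>
        Ideal.Quotient.mk _ (Quotient.out p.1 + ∑ i, Quotient.out (p.2 i) * g i)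
      have hF : Function.Surjective F := by
        intro z
        obtain ⟨x, rfl⟩ := Ideal.Quotient.mk_surjective z
        have hout : ∀ (I : Ideal R) (q : R ⧸ I), Ideal.Quotient.mk I (Quotient.out q) = q :=
          fun I q => Quotient.out_eq q
        let a := Ideal.Quotient.mk (maximalIdeal R ^ n) x
        have h1 : x - Quotient.out a ∈ maximalIdeal R ^ n := by
          rw [← Ideal.Quotient.eq, hout]
        obtain ⟨c, hc⟩ := (Submodule.mem_span_range_iff_exists_fun R).mp (hg.ge h1)
        refine ⟨(a, fun i => Ideal.Quotient.mk _ (c i)), ?_⟩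
        simp only [F]
        rw [eq_comm, Ideal.Quotient.eq]
        have h2 : x - (Quotient.out a + ∑ i, Quotient.out (Ideal.Quotient.mk (maximalIdeal R) (c i)) * g i)
            = ∑ i, (c i - Quotient.out (Ideal.Quotient.mk (maximalIdeal R) (c i))) * g i := by
          rw [← sub_sub, ← hc, ← Finset.sum_sub_distrib]
          refine Finset.sum_congr rfl fun i _ => ?_
          rw [sub_mul, smul_eq_mul]
        rw [h2]
        refine Ideal.sum_mem _ fun i _ => ?_
        rw [pow_succ']
        refine Ideal.mul_mem_mul ?_ ?_
        · rw [← Ideal.Quotient.eq, hout]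
        · rw [← hg]
          exact Submodule.subset_span ⟨i, rfl⟩
      exact small_of_surjective hF
  refine small_of_injective (f := fun (x : R) (n : ℕ) => Ideal.Quotient.mk (maximalIdeal R ^ n) x) ?_
  intro x y hxy
  rw [← sub_eq_zero]
  apply IsHausdorff.haus' (I := maximalIdeal R)
  intro n
  rw [SModEq.zero]
  simp only [smul_eq_mul, Ideal.mul_top]
  rw [← Ideal.Quotient.eq]
  exact congrFun hxy n

end MatlisAux

/-- Matlis duality for minimax modules: let `R` be a complete noetherian local ring with
residue field `𝕜`, and `E` an injective hull of `𝕜` (an injective `R`-module with an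
injective `R`-linear map `ι : 𝕜 → E` whose range is essential).  For every `R`-module `M`,
the canonical evaluation map `M → Hom_R(Hom_R(M, E), E)` is injective, and it is surjective
if and only if `M` is minimax. -/
theorem matlis_biduality_minimax
    (R : Type u) [CommRing R] [IsNoetherianRing R] [IsLocalRing R]
    [IsAdicComplete (IsLocalRing.maximalIdeal R) R]
    (E : Type v) [AddCommGroup E] [Module R E] [Module.Injective R E]
    (ι : IsLocalRing.ResidueField R →ₗ[R] E) (hι : Function.Injective ι)
    (hess : ∀ N : Submodule R E, N ≠ ⊥ → N ⊓ LinearMap.range ι ≠ ⊥)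
    (M : Type w) [AddCommGroup M] [Module R M] :
    Function.Injective (LinearMap.applyₗ : M →ₗ[R] (M →ₗ[R] E) →ₗ[R] E) ∧
      (Function.Surjective (LinearMap.applyₗ : M →ₗ[R] (M →ₗ[R] E) →ₗ[R] E) ↔
        ∃ N : Submodule R M, N.FG ∧ IsArtinian R (M ⧸ N)) := by
    classical
  have hk : ∀ (r : R), r ∈ IsLocalRing.maximalIdeal R → r • ι 1 = 0 := by
    intro r hr
    rw [← map_smul, Algebra.smul_def, mul_one]
    have : algebraMap R (IsLocalRing.ResidueField R) r = 0 :=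
      (IsLocalRing.residue_eq_zero_iff r).mpr hr
    rw [this, map_zero]
  have hsmall : Small.{v} (R ⧸ IsLocalRing.maximalIdeal R) :=
    small_of_injective (f := fun x : R ⧸ IsLocalRing.maximalIdeal R => ι x) hι
  have hR : Small.{v} R := MatlisAux.small_ring R
  have h : MatlisAux.Hull R E (ι 1) := by
    refine ⟨Module.Baer.of_injective inferInstance, ?_, hk, ?_⟩
    · intro h0
      exact one_ne_zero (hι (h0.trans (map_zero ι).symm))
    · intro N hN
      obtain ⟨x, ⟨hxN, c, rfl⟩, hx0⟩ := Submodule.exists_mem_ne_zero_of_ne_bot (hess N hN)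
      have hc : c ≠ 0 := by
        rintro rfl
        exact hx0 (map_zero ι)
      obtain ⟨r, hr⟩ := IsLocalRing.residue_surjective c⁻¹
      have h1 : r • c = 1 := by
        rw [Algebra.smul_def]
        have : algebraMap R (IsLocalRing.ResidueField R) r = c⁻¹ := hr
        rw [this, inv_mul_cancel₀ hc]
      rw [← h1, map_smul]
      exact N.smul_mem r hxN
  refine ⟨?_, ?_⟩
  · rw [injective_iff_map_eq_zero]
    intro m hm
    by_contra hne
    obtain ⟨f, hf⟩ := h.cog hne
    exact hf (LinearMap.congr_fun hm f)
  · have key : Function.Surjective (LinearMap.applyₗ : M →ₗ[R] (M →ₗ[R] E) →ₗ[R] E) ↔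
        MatlisAux.Rfl R E M := by
      constructor
      · intro hs φ
        obtain ⟨m, rfl⟩ := hs φ
        exact ⟨m, fun f => rfl⟩
      · intro hs φ
        obtain ⟨m, hm⟩ := hs φ
        exact ⟨m, LinearMap.ext fun f => (hm f).symm⟩
    rw [key]
    constructor
    · exact fun hM => h.minimax_of_rfl hM
    · rintro ⟨N, hN, hA⟩
      exact h.rfl_of_minimax N hN hA
end
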